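/- arXiv:1206.6950 — 5 statements merged into one kernel-verified Lean document; each statement's English description precedes it below -/
import Mathlib

section
/- Let M be an m × n real matrix and let C := {j ∈ {1,…,n} : column j of M does not belong to the linear span of the columns of M with index strictly less than j}. Let M' := M[{1,…,m}, C] be the submatrix of M keeping all rows and only the columns in C. Then for every i ∈ {1,…,m}: row i of M' belongs to the linear span of the rows of M' with index strictly less than i if and only if row i of M belongs to the linear span of the rows of M with index strictly less than i. -/
/-- The set of row indices `i` such that row `i` of `M` does not belong to the linear span
of the rows of `M` with index strictly less than `i`. -/
noncomputable def rowStar {m n : ℕ} (M : Matrix (Fin m) (Fin n) ℝ) : Finset (Fin m) :=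
  @Finset.filter (Fin m)
    (fun i => M i ∉ Submodule.span ℝ ((fun i' : Fin m => M i') '' {i' | i' < i}))
    (Classical.decPred _) Finset.univ

/-- A vector in the row space of `M` that vanishes on every column of `M` outside the span of the
preceding columns is zero. -/
theorem eq_zero_of_mem_span_rows {m n : ℕ} (M : Matrix (Fin m) (Fin n) ℝ) {v : Fin n → ℝ}
    (hv : v ∈ Submodule.span ℝ (Set.range M)) (h : ∀ j ∈ rowStar M.transpose, v j = 0) :
    v = 0 := by
  obtain ⟨c, rfl⟩ := (Submodule.mem_span_range_iff_exists_fun ℝ).1 hv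
  have hL (j : Fin n) : (∑ i, c i • M i) j =
      (∑ i, c i • LinearMap.proj i : (Fin m → ℝ) →ₗ[ℝ] ℝ) (M.transpose j) := by
    simp [Finset.sum_apply]
  funext j
  induction j using WellFoundedLT.induction with
  | ind j ih =>
    by_cases hj : j ∈ rowStar M.transpose
    · exact h j hj
    · have hspan : M.transpose j ∈ Submodule.span ℝ (M.transpose '' {j' | j' < j}) := by
        simpa [rowStar] using hj
      rw [hL]
      refine LinearMap.mem_ker.1 (Submodule.span_le.2 ?_ hspan)
      rintro _ ⟨j', hj', rfl⟩
      exact LinearMap.mem_ker.2 ((hL j').symm.trans (ih j' hj'))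

/-- Let `C` be the set of columns of `M` not in the span of the preceding
columns, and `M'` the submatrix of `M` keeping all rows and the columns in `C`. Then row `i`
of `M'` lies in the span of the earlier rows of `M'` iff row `i` of `M` lies in the span of
the earlier rows of `M`. -/
theorem statement11 {m n : ℕ} (M : Matrix (Fin m) (Fin n) ℝ) (i : Fin m) :
    ((M.submatrix id (fun j : ↥(rowStar M.transpose) => (j : Fin n))) i ∈
        Submodule.span ℝ
          ((fun i' : Fin m =>
            (M.submatrix id (fun j : ↥(rowStar M.transpose) => (j : Fin n))) i') ''
            {i' | i' < i})) ↔
      (M i ∈ Submodule.span ℝ ((fun i' : Fin m => M i') '' {i' | i' < i})) := by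
  let f : (Fin n → ℝ) →ₗ[ℝ] (↥(rowStar M.transpose) → ℝ) :=
    LinearMap.funLeft ℝ ℝ (fun j : ↥(rowStar M.transpose) => (j : Fin n))
  have himage : (fun i' : Fin m =>
      (M.submatrix id (fun j : ↥(rowStar M.transpose) => (j : Fin n))) i') '' {i' | i' < i} =
      f '' ((fun i' : Fin m => M i') '' {i' | i' < i}) := by
    rw [Set.image_image]
    rfl
  rw [himage, Submodule.span_image]
  refine ⟨?_, fun h => Submodule.mem_map_of_mem (f := f) h⟩
  rintro ⟨w, hw, hfw⟩
  have hrow : M i - w ∈ Submodule.span ℝ (Set.range M) :=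
    sub_mem (Submodule.subset_span (Set.mem_range_self i))
      (Submodule.span_mono (Set.image_subset_range _ _) hw)
  have hzero : M i - w = 0 := eq_zero_of_mem_span_rows M hrow fun j hj =>
    sub_eq_zero.2 (congrFun hfw ⟨j, hj⟩).symm
  rwa [sub_eq_zero.1 hzero]
end

section
/- Let F be a separable real Banach space, let A ⊆ F be a Borel set, and suppose there exists a finite-dimensional subspace E ⊆ F of positive dimension such that for every f ∈ F the set (A + f) ∩ E has measure zero with respect to a Haar (Lebesgue) measure on E. Then A is Haar null: there exists a Borel probability measure μ on F such that μ(A + f) = 0 for every f ∈ F. -/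
/-- If a Borel set `A` in a separable Banach space `F` admits a probe,
i.e. a finite-dimensional subspace `E` of positive dimension (identified with `ℝ^d` via a
linear equivalence `φ`) such that every translate `(A + f) ∩ E` is Lebesgue null in `E`,
then `A` is Haar null. -/
theorem statement13
    {F : Type*} [NormedAddCommGroup F] [NormedSpace ℝ F] [CompleteSpace F]
    [TopologicalSpace.SeparableSpace F] [MeasurableSpace F] [BorelSpace F]
    (A : Set F) (hA : MeasurableSet A)
    (E : Submodule ℝ F) [FiniteDimensional ℝ E] (hE : 0 < Module.finrank ℝ E)
    (φ : (Fin (Module.finrank ℝ E) → ℝ) ≃ₗ[ℝ] ↥E)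
    (hprobe : ∀ f : F,
      MeasureTheory.volume {v : Fin (Module.finrank ℝ E) → ℝ | ((φ v : F) - f) ∈ A} = 0) :
    ∃ μ : MeasureTheory.Measure F, MeasureTheory.IsProbabilityMeasure μ ∧
      ∀ f : F, μ ((fun a => a + f) '' A) = 0 := by
  have hφ : Measurable fun v => (φ v : F) :=
    (E.subtype ∘ₗ φ.toLinearMap).continuous_of_finiteDimensional.measurable
  have hcube : MeasureTheory.IsProbabilityMeasure
      (MeasureTheory.volume.restrict
        (Set.Icc (0 : Fin (Module.finrank ℝ E) → ℝ) 1)) :=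
    ⟨by simp [Real.volume_Icc_pi]⟩
  refine ⟨(MeasureTheory.volume.restrict
      (Set.Icc (0 : Fin (Module.finrank ℝ E) → ℝ) 1)).map fun v => (φ v : F),
    MeasureTheory.Measure.isProbabilityMeasure_map hφ.aemeasurable, fun f => ?_⟩
  have himage : (fun a => a + f) '' A = (fun a => a - f) ⁻¹' A := by
    simp [Set.image_add_right, sub_eq_add_neg]
  rw [himage, MeasureTheory.Measure.map_apply hφ (measurable_sub_const f hA)]
  exact MeasureTheory.Measure.absolutelyContinuous_of_le
    MeasureTheory.Measure.restrict_le_self (hprobe f)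
end

section
/- Let n, k ≥ 1 and let P : ℝ^k × ℝ^n → ℝ be of class C^3. Denote by ∇_x P(t,x) ∈ ℝ^n the gradient of P(t,·) at x and by H_x P(t,x) the Hessian matrix of P(t,·) at x, and assume that the map e₂(t,x) := (∇_x P(t,x), H_x P(t,x)), from ℝ^k × B^n into ℝ^n × Sym_n(ℝ), has surjective differential at every point of ℝ^k × B^n (where B^n is the open unit ball of ℝ^n and Sym_n(ℝ) the space of symmetric n × n real matrices). Then the set N := {t ∈ ℝ^k : there exists x ∈ B^n with ∇_x P(t,x) = 0 and det H_x P(t,x) = 0} of parameters t for which P(t,·) is not a Morse function on B^n has Hausdorff dimension at most k − 1; in particular N has Lebesgue measure zero in ℝ^k. -/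
open scoped ENNReal

/-- The gradient of `f : ℝ^n → ℝ` at `x`. -/
noncomputable def gradF {n : ℕ} (f : (Fin n → ℝ) → ℝ) (x : Fin n → ℝ) : Fin n → ℝ :=
  fun i => fderiv ℝ f x (Pi.single i 1)

/-- The Hessian matrix of `f : ℝ^n → ℝ` at `x` (as a function `Fin n → Fin n → ℝ`). -/
noncomputable def hessF {n : ℕ} (f : (Fin n → ℝ) → ℝ) (x : Fin n → ℝ) :
    Fin n → Fin n → ℝ :=
  fun i j => fderiv ℝ (fun y => fderiv ℝ f y (Pi.single j 1)) x (Pi.single i 1)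

open scoped Topology

open Module

/-- A set on which `f : E → F` is locally constant, and at whose points `f` is strictly
differentiable with surjective derivative, has Hausdorff dimension at most `dim E - dim F`. -/
theorem dimH_le_finrank_sub_of_locally_const {E F : Type*} [NormedAddCommGroup E] [NormedSpace ℝ E]
    [FiniteDimensional ℝ E] [NormedAddCommGroup F] [NormedSpace ℝ F] [FiniteDimensional ℝ F]
    {s : Set E} {f : E → F} {f' : E → E →L[ℝ] F}
    (hf : ∀ a ∈ s, HasStrictFDerivAt f (f' a) a) (hf' : ∀ a ∈ s, (f' a).range = ⊤)
    (hs : ∀ a ∈ s, ∀ᶠ x in 𝓝[s] a, f x = f a) :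
    dimH s ≤ ((finrank ℝ E - finrank ℝ F : ℕ) : ℝ≥0∞) := by
  have : CompleteSpace E := FiniteDimensional.complete ℝ E
  by_contra! hlt
  obtain ⟨a, ha, hdim⟩ := exists_mem_nhdsWithin_lt_dimH_of_lt_dimH hlt
  have hfa := hf a ha
  set φ := hfa.implicitToOpenPartialHomeomorph f (f' a) (hf' a ha) with hφ
  obtain ⟨K, u, hu, hKu⟩ := (hfa.to_implicitFunction (hf' a ha)).exists_lipschitzOnWith
  have hφa : Filter.Tendsto (fun x => (φ x).2) (𝓝 a) (𝓝 0) := by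
    have h := φ.continuousAt (hfa.mem_implicitToOpenPartialHomeomorph_source (hf' a ha))
    have h2 := (continuous_snd.tendsto _).comp h
    rw [hφ, hfa.implicitToOpenPartialHomeomorph_self] at h2
    exact h2
  have hcover : (hfa.implicitFunction f (f' a) (hf' a ha) (f a)) '' u ∈ 𝓝[s] a := by
    filter_upwards [hs a ha, nhdsWithin_le_nhds (hfa.eq_implicitFunction (hf' a ha)),
      nhdsWithin_le_nhds (hφa hu)] with x hx hx_eq hxu
    exact ⟨(φ x).2, hxu, by rw [← hx]; exact hx_eq⟩
  refine (hdim _ hcover).not_ge ?_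
  calc dimH (hfa.implicitFunction f (f' a) (hf' a ha) (f a) '' u)
      ≤ dimH u := hKu.dimH_image_le
    _ ≤ dimH (Set.univ : Set (f' a).ker) := dimH_mono (Set.subset_univ u)
    _ = (finrank ℝ (f' a).ker : ℝ≥0∞) := Real.dimH_univ_eq_finrank _
    _ = ((finrank ℝ E - finrank ℝ F : ℕ) : ℝ≥0∞) := by
      have h := LinearMap.finrank_range_add_finrank_ker (f' a : E →ₗ[ℝ] F)
      have hr : finrank ℝ (LinearMap.range (f' a : E →ₗ[ℝ] F)) = finrank ℝ F := by
        rw [show LinearMap.range (f' a : E →ₗ[ℝ] F) = ⊤ from hf' a ha, finrank_top]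
      rw [hr] at h
      congr 1
      omega

/-- The `m`-th leading principal minor of a square array. -/
noncomputable def leadingMinor {n m : ℕ} (h : m ≤ n) (S : Fin n → Fin n → ℝ) : ℝ :=
  ((Matrix.of S).submatrix (Fin.castLE h) (Fin.castLE h)).det

/-- If the determinant vanishes, then some leading principal minor vanishes while the preceding
one does not. -/
theorem exists_leadingMinor_eq_zero {n : ℕ} {S : Fin n → Fin n → ℝ} (hS : (Matrix.of S).det = 0) :
    ∃ m : Fin n, leadingMinor (Nat.succ_le_of_lt m.2) S = 0 ∧ leadingMinor m.2.le S ≠ 0 := by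
  classical
  have hex : ∃ m, ∃ h : m ≤ n, leadingMinor h S = 0 := ⟨n, le_rfl, hS⟩
  obtain ⟨hle, hzero⟩ := Nat.find_spec hex
  have hmin := fun m => Nat.find_min hex (m := m)
  generalize Nat.find hex = N at hle hzero hmin
  cases N with
  | zero => simp [leadingMinor] at hzero
  | succ m => exact ⟨⟨m, hle⟩, hzero, fun h => hmin m m.lt_succ_self ⟨_, h⟩⟩

theorem contDiff_leadingMinor {n m : ℕ} (h : m ≤ n) {r : WithTop ℕ∞} :
    ContDiff ℝ r (leadingMinor h) := by
  unfold leadingMinor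
  simp only [Matrix.det_apply, Matrix.submatrix_apply, Matrix.of_apply]
  refine ContDiff.sum fun σ _ => ContDiff.const_smul _ (contDiff_prod fun i _ => ?_)
  fun_prop

/-- The array with a single entry `1` in the `m`-th diagonal position. -/
def diagUnit {n : ℕ} (m : Fin n) : Fin n → Fin n → ℝ := Pi.single m (Pi.single m 1)

theorem isSymm_of_smul_diagUnit {n : ℕ} (m : Fin n) (c : ℝ) :
    (Matrix.of (c • diagUnit m)).IsSymm := by
  ext i j
  by_cases hi : i = m <;> by_cases hj : j = m <;> simp [diagUnit, hi, hj]

/-- A leading principal minor is affine in its last diagonal entry, with slope the preceding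
minor. -/
theorem leadingMinor_add_smul_diagUnit {n : ℕ} (m : Fin n) (S : Fin n → Fin n → ℝ) (c : ℝ) :
    leadingMinor (Nat.succ_le_of_lt m.2) (S + c • diagUnit m) =
      leadingMinor (Nat.succ_le_of_lt m.2) S + c * leadingMinor m.2.le S := by
  set A := (Matrix.of S).submatrix (Fin.castLE (Nat.succ_le_of_lt m.2))
    (Fin.castLE (Nat.succ_le_of_lt m.2)) with hA
  have hlast : ∀ i : Fin (m + 1), Fin.castLE (Nat.succ_le_of_lt m.2) i = m ↔ i = Fin.last m := by
    simp [Fin.ext_iff]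
  have hrow : (Matrix.of (S + c • diagUnit m)).submatrix (Fin.castLE (Nat.succ_le_of_lt m.2))
      (Fin.castLE (Nat.succ_le_of_lt m.2)) =
      A.updateRow (Fin.last m) (A (Fin.last m) + c • Pi.single (Fin.last m) 1) := by
    ext i j
    by_cases hi : i = Fin.last m
    · subst hi
      simp [hA, diagUnit, Pi.single_apply, hlast, (hlast (Fin.last m)).2 rfl]
    · simp [hA, diagUnit, hlast, hi]
  have hminor : (A.updateRow (Fin.last m) (Pi.single (Fin.last m) 1)).det =
      leadingMinor m.2.le S := by
    rw [← Matrix.adjugate_apply, Matrix.adjugate_fin_succ_eq_det_submatrix, Fin.succAbove_last,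
      Even.neg_one_pow ⟨_, rfl⟩, one_mul]
    rfl
  unfold leadingMinor at hminor ⊢
  rw [hrow, Matrix.det_updateRow_add, Matrix.det_updateRow_smul, Matrix.updateRow_eq_self, hminor]

theorem fderiv_leadingMinor_diagUnit {n : ℕ} (m : Fin n) (S : Fin n → Fin n → ℝ) :
    fderiv ℝ (leadingMinor (Nat.succ_le_of_lt m.2)) S (diagUnit m) = leadingMinor m.2.le S := by
  have hd : DifferentiableAt ℝ (leadingMinor (Nat.succ_le_of_lt m.2)) S :=
    (contDiff_leadingMinor _ (r := 1)).differentiable one_ne_zero S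
  rw [← hd.lineDeriv_eq_fderiv, lineDeriv]
  simp [leadingMinor_add_smul_diagUnit]

theorem contDiff_partial_fderiv_apply {E F : Type*} [NormedAddCommGroup E] [NormedSpace ℝ E]
    [NormedAddCommGroup F] [NormedSpace ℝ F] {Q : E × F → ℝ} {r q : WithTop ℕ∞}
    (hQ : ContDiff ℝ q Q) (hr : r + 1 ≤ q) (v : F) :
    ContDiff ℝ r fun p : E × F => fderiv ℝ (fun x' => Q (p.1, x')) p.2 v := by
  refine ContDiff.fderiv_apply (m := q) (f := fun (p : E × F) x' => Q (p.1, x')) ?_ contDiff_snd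
    contDiff_const hr
  exact hQ.comp (by fun_prop : ContDiff ℝ q fun z : (E × F) × F => (z.1.1, z.2))

/-- The map `(t, x) ↦ (∇ₓP (t,x), HₓP (t,x))` of a `C^3` function is `C^1`. -/
theorem contDiff_gradF_hessF {k n : ℕ} {P : (Fin k → ℝ) × (Fin n → ℝ) → ℝ}
    (hP : ContDiff ℝ (3 : ℕ) P) :
    ContDiff ℝ 1 fun p : (Fin k → ℝ) × (Fin n → ℝ) =>
      (gradF (fun x' => P (p.1, x')) p.2, hessF (fun x' => P (p.1, x')) p.2) := by
  have h2 : ∀ i : Fin n, ContDiff ℝ 2 fun p : (Fin k → ℝ) × (Fin n → ℝ) =>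
      fderiv ℝ (fun x' => P (p.1, x')) p.2 (Pi.single i 1) := fun i =>
    contDiff_partial_fderiv_apply hP (by norm_num) _
  refine ContDiff.prodMk (contDiff_pi.2 fun i => (h2 i).of_le (by norm_num))
    (contDiff_pi.2 fun i => contDiff_pi.2 fun j => ?_)
  exact contDiff_partial_fderiv_apply (h2 j) (by norm_num) _

/-- If `P : ℝ^k × ℝ^n → ℝ` is `C^3` and the evaluation map
`e₂ (t, x) = (∇ₓP (t,x), HₓP (t,x))` has differential whose range contains `ℝ^n × Symₙ(ℝ)`
at every point of `ℝ^k × Bⁿ`, then the set of parameters `t` for which `P (t, ·)` is not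
Morse on `Bⁿ` has Hausdorff dimension at most `k - 1`; in particular it is Lebesgue null. -/
theorem statement14 {k n : ℕ} (hk : 1 ≤ k) (hn : 1 ≤ n)
    (P : (Fin k → ℝ) × (Fin n → ℝ) → ℝ) (hP : ContDiff ℝ (3 : ℕ) P)
    (hsub : ∀ (t : Fin k → ℝ) (x : Fin n → ℝ), ‖x‖ < 1 →
      ∀ (v : Fin n → ℝ) (S : Fin n → Fin n → ℝ), (Matrix.of S).IsSymm →
        ∃ w : (Fin k → ℝ) × (Fin n → ℝ),
          fderiv ℝ (fun p : (Fin k → ℝ) × (Fin n → ℝ) =>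
            (gradF (fun x' => P (p.1, x')) p.2, hessF (fun x' => P (p.1, x')) p.2)) (t, x) w
            = (v, S)) :
    dimH {t : Fin k → ℝ | ∃ x : Fin n → ℝ, ‖x‖ < 1 ∧
        gradF (fun x' => P (t, x')) x = 0 ∧
        (Matrix.of (hessF (fun x' => P (t, x')) x)).det = 0} ≤ (k : ℝ≥0∞) - 1 ∧
    MeasureTheory.volume {t : Fin k → ℝ | ∃ x : Fin n → ℝ, ‖x‖ < 1 ∧
        gradF (fun x' => P (t, x')) x = 0 ∧
        (Matrix.of (hessF (fun x' => P (t, x')) x)).det = 0} = 0 := by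
  set e : (Fin k → ℝ) × (Fin n → ℝ) → (Fin n → ℝ) × (Fin n → Fin n → ℝ) := fun p =>
    (gradF (fun x' => P (p.1, x')) p.2, hessF (fun x' => P (p.1, x')) p.2)
  have heC : ContDiff ℝ 1 e := contDiff_gradF_hessF hP
  set N : Set (Fin k → ℝ) := {t | ∃ x : Fin n → ℝ, ‖x‖ < 1 ∧
    gradF (fun x' => P (t, x')) x = 0 ∧
    (Matrix.of (hessF (fun x' => P (t, x')) x)).det = 0}
  let W : Fin n → Set ((Fin k → ℝ) × (Fin n → ℝ)) := fun m => {p | ‖p.2‖ < 1 ∧ (e p).1 = 0 ∧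
    leadingMinor (Nat.succ_le_of_lt m.2) (e p).2 = 0 ∧ leadingMinor m.2.le (e p).2 ≠ 0}
  have hN : N ⊆ Prod.fst '' ⋃ m, W m := by
    rintro t ⟨x, hx, hgrad, hdet⟩
    obtain ⟨m, hm⟩ := exists_leadingMinor_eq_zero hdet
    exact ⟨(t, x), Set.mem_iUnion.2 ⟨m, hx, hgrad, hm⟩, rfl⟩
  have hW : ∀ m, dimH (W m) ≤ ((k - 1 : ℕ) : ℝ≥0∞) := by
    intro m
    let g : (Fin k → ℝ) × (Fin n → ℝ) → (Fin n → ℝ) × ℝ := fun p =>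
      ((e p).1, leadingMinor (Nat.succ_le_of_lt m.2) (e p).2)
    let g' : (Fin k → ℝ) × (Fin n → ℝ) → (Fin k → ℝ) × (Fin n → ℝ) →L[ℝ] (Fin n → ℝ) × ℝ :=
      fun p =>
      ((ContinuousLinearMap.fst ℝ _ _).comp (fderiv ℝ e p)).prod
        ((fderiv ℝ (leadingMinor (Nat.succ_le_of_lt m.2)) (e p).2).comp
          ((ContinuousLinearMap.snd ℝ _ _).comp (fderiv ℝ e p)))
    have hdim := dimH_le_finrank_sub_of_locally_const (s := W m) (f := g) (f' := g') ?_ ?_ ?_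
    · simpa [Nat.add_sub_add_right, add_comm n 1, ← add_assoc] using hdim
    · intro a _
      have hea : HasStrictFDerivAt e (fderiv ℝ e a) a :=
        heC.contDiffAt.hasStrictFDerivAt one_ne_zero
      exact hea.fst.prodMk (((contDiff_leadingMinor _ (r := 1)).contDiffAt.hasStrictFDerivAt
        one_ne_zero).comp a hea.snd)
    · rintro ⟨t, x⟩ ⟨hx, -, -, hm⟩
      refine LinearMap.range_eq_top.2 fun ⟨v, c⟩ => ?_
      obtain ⟨w, hw⟩ := hsub t x hx v _
        (isSymm_of_smul_diagUnit m (c / leadingMinor m.2.le (e (t, x)).2))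
      refine ⟨w, ?_⟩
      change ((fderiv ℝ e (t, x) w).1, fderiv ℝ (leadingMinor (Nat.succ_le_of_lt m.2)) (e (t, x)).2
        (fderiv ℝ e (t, x) w).2) = (v, c)
      rw [hw, map_smul, fderiv_leadingMinor_diagUnit, smul_eq_mul, div_mul_cancel₀ _ hm]
    · intro a ha
      filter_upwards [self_mem_nhdsWithin] with x hx
      simp only [g, hx.2.1, hx.2.2.1, ha.2.1, ha.2.2.1]
  have hdim : dimH N ≤ ((k - 1 : ℕ) : ℝ≥0∞) := calc
    dimH N ≤ dimH (Prod.fst '' ⋃ m, W m) := dimH_mono hN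
    _ ≤ dimH (⋃ m, W m) := LipschitzWith.prod_fst.dimH_image_le _
    _ ≤ _ := by rw [dimH_iUnion]; exact iSup_le hW
  refine ⟨by simpa using hdim, ?_⟩
  refine measure_zero_of_dimH_lt (d := (k : NNReal)) ?_ (hdim.trans_lt ?_)
  · rw [← MeasureTheory.hausdorffMeasure_pi_real, Fintype.card_fin]
    simp [MeasureTheory.Measure.AbsolutelyContinuous.rfl]
  · exact_mod_cast Nat.sub_lt hk one_pos
end

section
/- Let m, n ≥ 1 and c ≥ 1, let U ⊆ ℝ^m be open, and let g : U → ℝ^c be a C^∞ map whose differential dg_y is surjective at every point y of A := g^{-1}(0). Let Ã := {(y, l) ∈ U × L(ℝ^n, ℝ^m) : g(y) = 0 and the composition dg_y ∘ l : ℝ^n → ℝ^c is not surjective}, where L(ℝ^n, ℝ^m) denotes the space of linear maps from ℝ^n to ℝ^m. Then the Hausdorff dimension of à (as a subset of ℝ^m × L(ℝ^n, ℝ^m) ≅ ℝ^{m + nm}) is at most m + n·m − (n + 1); in particular à has Lebesgue measure zero. -/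
open scoped ENNReal

open Module Topology in
/-- A set on which a map is constant, and at each point of which the map is strictly
differentiable with surjective derivative, has Hausdorff dimension at most the difference of the
dimensions of the source and of the target. -/
theorem dimH_le_of_surjective_fderiv {E F : Type*}
    [NormedAddCommGroup E] [NormedSpace ℝ E] [FiniteDimensional ℝ E]
    [NormedAddCommGroup F] [NormedSpace ℝ F] [FiniteDimensional ℝ F]
    {f : E → F} {z : F} {s : Set E} {d : ℕ} (hd : finrank ℝ E ≤ d + finrank ℝ F)
    (hs : ∀ x ∈ s, f x = z)
    (hf : ∀ x ∈ s, ∃ f' : E →L[ℝ] F, HasStrictFDerivAt f f' x ∧ Function.Surjective f') :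
    dimH s ≤ d := by
  have : CompleteSpace E := FiniteDimensional.complete ℝ E
  refine le_of_not_gt fun hlt => ?_
  obtain ⟨a, ha, hta⟩ := exists_mem_nhdsWithin_lt_dimH_of_lt_dimH hlt
  obtain ⟨f', hf', hsurj⟩ := hf a ha
  have hrange : f'.range = ⊤ := LinearMap.range_eq_top.2 hsurj
  obtain ⟨K, t, ht, hLip⟩ := (hf'.to_implicitFunction hrange).exists_lipschitzOnWith
  let φ := hf'.implicitToOpenPartialHomeomorph f f' hrange
  have hcont : Filter.Tendsto (fun x => (φ x).2) (𝓝 a) (𝓝 0) := by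
    have h := φ.continuousAt (hf'.mem_implicitToOpenPartialHomeomorph_source hrange)
    have h0 : (φ a).2 = 0 := by simp [φ]
    simpa only [ContinuousAt, Function.comp_def, h0] using (continuous_snd.tendsto (φ a)).comp h
  have hmem : hf'.implicitFunction f f' hrange (f a) '' t ∩ s ∈ 𝓝[s] a := by
    refine Filter.inter_mem ?_ self_mem_nhdsWithin
    filter_upwards [nhdsWithin_le_nhds (hf'.eq_implicitFunction hrange),
      nhdsWithin_le_nhds (hcont ht), self_mem_nhdsWithin] with x hx hxt hxs
    exact ⟨(φ x).2, hxt, by rw [hs a ha, ← hs x hxs]; exact hx⟩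
  refine (hta _ hmem).not_ge ?_
  have hker : finrank ℝ f'.ker ≤ d := by
    have h := f'.toLinearMap.finrank_range_add_finrank_ker
    have h' : finrank ℝ f'.range = finrank ℝ F := by rw [hrange, finrank_top]
    change finrank ℝ f'.range + finrank ℝ f'.ker = _ at h
    omega
  calc dimH (hf'.implicitFunction f f' hrange (f a) '' t ∩ s)
      ≤ dimH (hf'.implicitFunction f f' hrange (f a) '' t) := dimH_mono Set.inter_subset_left
    _ ≤ dimH t := hLip.dimH_image_le
    _ ≤ dimH (Set.univ : Set f'.ker) := dimH_mono (Set.subset_univ _)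
    _ = (finrank ℝ f'.ker : ℝ≥0∞) := Real.dimH_univ_eq_finrank _
    _ ≤ d := by exact_mod_cast hker

/-- The row vector `w · dg_y · l`, as a function of `(y, w, l)`. -/
noncomputable def covectorPullback {m c : ℕ} (n : ℕ) (g : (Fin m → ℝ) → (Fin c → ℝ))
    (p : (Fin m → ℝ) × (Fin c → ℝ) × (Fin m → Fin n → ℝ)) : Fin n → ℝ :=
  fun k => p.2.1 ⬝ᵥ fderiv ℝ g p.1 (fun r => p.2.2 r k)

theorem contDiffAt_covectorPullback {m n c : ℕ} {g : (Fin m → ℝ) → (Fin c → ℝ)}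
    {p : (Fin m → ℝ) × (Fin c → ℝ) × (Fin m → Fin n → ℝ)} (hg : ContDiffAt ℝ 2 g p.1) :
    ContDiffAt ℝ 1 (covectorPullback n g) p := by
  have hg' : ContDiffAt ℝ 1 (fderiv ℝ g) p.1 := hg.fderiv_right (by norm_num)
  have hcomp : ContDiffAt ℝ 1
      (fun q : (Fin m → ℝ) × (Fin c → ℝ) × (Fin m → Fin n → ℝ) => fderiv ℝ g q.1) p :=
    hg'.comp p contDiffAt_fst
  refine contDiffAt_pi.2 fun k => ?_
  simp only [covectorPullback, dotProduct]
  refine ContDiffAt.sum fun j _ => ContDiffAt.mul (by fun_prop) ?_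
  have hcol : ContDiffAt ℝ 1 (fun q : (Fin m → ℝ) × (Fin c → ℝ) × (Fin m → Fin n → ℝ) =>
      fun r => q.2.2 r k) p := by fun_prop
  exact contDiffAt_pi.1 (hcomp.clm_apply hcol) j

theorem covectorPullback_add_smul {m n c : ℕ} (g : (Fin m → ℝ) → (Fin c → ℝ)) (y : Fin m → ℝ)
    (w : Fin c → ℝ) (l v : Fin m → Fin n → ℝ) (t : ℝ) :
    covectorPullback n g (y, w, l + t • v) =
      covectorPullback n g (y, w, l) + t • covectorPullback n g (y, w, v) := by
  ext k
  have h : (fun r => (l + t • v) r k) = (fun r => l r k) + t • fun r => v r k := rfl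
  change w ⬝ᵥ fderiv ℝ g y (fun r => (l + t • v) r k) = _
  rw [h, map_add, map_smul, dotProduct_add, dotProduct_smul]
  rfl

theorem fderiv_covectorPullback_apply {m n c : ℕ} {g : (Fin m → ℝ) → (Fin c → ℝ)}
    {p : (Fin m → ℝ) × (Fin c → ℝ) × (Fin m → Fin n → ℝ)}
    (hd : DifferentiableAt ℝ (covectorPullback n g) p) (v : Fin m → Fin n → ℝ) :
    fderiv ℝ (covectorPullback n g) p (0, 0, v) = covectorPullback n g (p.1, p.2.1, v) := by
  have hline := hd.hasFDerivAt.hasLineDerivAt (0, 0, v)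
  refine HasDerivAt.unique hline ?_
  have heq : (fun t : ℝ => covectorPullback n g (p + t • (0, 0, v))) =
      fun t => covectorPullback n g p + t • covectorPullback n g (p.1, p.2.1, v) := by
    funext t
    rw [← covectorPullback_add_smul]
    simp [Prod.add_def]
  rw [heq]
  simpa using ((hasDerivAt_id (0 : ℝ)).smul_const
    (covectorPullback n g (p.1, p.2.1, v))).const_add (covectorPullback n g p)

/-- The incidence set of triples `(y, w, l)` with `g y = 0`, `w i = 1` and `w · dg_y · l = 0`
has codimension at least `c + 1 + n`. -/
theorem dimH_incidence_le {m n c d : ℕ} {U : Set (Fin m → ℝ)} {g : (Fin m → ℝ) → (Fin c → ℝ)}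
    (hg : ∀ y ∈ U, ContDiffAt ℝ 2 g y)
    (hsurj : ∀ y ∈ U, g y = 0 → Function.Surjective (fderiv ℝ g y)) (i : Fin c)
    (hd : m + n * m ≤ d + (n + 1)) :
    dimH {p : (Fin m → ℝ) × (Fin c → ℝ) × (Fin m → Fin n → ℝ) |
      p.1 ∈ U ∧ g p.1 = 0 ∧ p.2.1 i = 1 ∧ covectorPullback n g p = 0} ≤ d := by
  refine dimH_le_of_surjective_fderiv
    (f := fun p => (g p.1, p.2.1 i, covectorPullback n g p)) (z := (0, 1, 0)) ?_ ?_ ?_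
  · simp only [Module.finrank_prod, Module.finrank_pi, Module.finrank_pi_fintype,
      Module.finrank_self, Fintype.card_fin, Finset.sum_const, Finset.card_univ, smul_eq_mul]
    nlinarith
  · rintro p ⟨-, h0, h1, h2⟩
    simp [h0, h1, h2]
  · rintro p ⟨hU, h0, h1, -⟩
    have hH := contDiffAt_covectorPullback (n := n) (hg _ hU)
    have hd1 := ((hg _ hU).hasStrictFDerivAt (by norm_num)).comp p
      (hasStrictFDerivAt_fst (𝕜 := ℝ))
    have hd2 := ((ContinuousLinearMap.proj (R := ℝ) (φ := fun _ : Fin c => ℝ) i).comp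
      ((ContinuousLinearMap.fst ℝ _ _).comp (ContinuousLinearMap.snd ℝ (Fin m → ℝ)
        ((Fin c → ℝ) × (Fin m → Fin n → ℝ))))).hasStrictFDerivAt (x := p)
    have hd3 := hH.hasStrictFDerivAt (by norm_num)
    refine ⟨_, hd1.prodMk (hd2.prodMk hd3), ?_⟩
    rintro ⟨a, b, e⟩
    obtain ⟨u, hu⟩ := hsurj _ hU h0 a
    obtain ⟨v, hv⟩ := hsurj _ hU h0 (Pi.single i 1)
    set D := fderiv ℝ (covectorPullback n g) p with hD
    set e' := e - D (u, (fun _ => b), 0) with he'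
    have hcol : D (0, 0, fun r k => e' k * v r) = e' := by
      rw [hD, fderiv_covectorPullback_apply (hH.differentiableAt (by norm_num))]
      ext k
      have : (fun r => e' k * v r) = e' k • v := rfl
      simp [covectorPullback, this, hv, h1]
    refine ⟨(u, (fun _ => b), 0) + (0, 0, fun r k => e' k * v r), ?_⟩
    refine Prod.ext ?_ (Prod.ext ?_ ?_)
    · simp [hu]
    · simp
    · change D _ = e
      rw [map_add, hcol, he']
      abel

/-- A linear map into `ℝ^c` that is not surjective is annihilated by a covector one of whose
coordinates is `1`. -/
theorem exists_dotProduct_eq_zero_of_not_surjective {V : Type*} [AddCommGroup V] [Module ℝ V]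
    {c : ℕ} {f : V →ₗ[ℝ] (Fin c → ℝ)} (hf : ¬ Function.Surjective f) :
    ∃ (i : Fin c) (w : Fin c → ℝ), w i = 1 ∧ ∀ v, w ⬝ᵥ f v = 0 := by
  obtain ⟨φ, hφ, hle⟩ := Submodule.exists_le_ker_of_lt_top f.range
    (lt_top_iff_ne_top.2 fun h => hf (LinearMap.range_eq_top.1 h))
  obtain ⟨i, hi⟩ : ∃ i, φ (Pi.single i 1) ≠ 0 := by
    by_contra! h
    exact hφ (LinearMap.pi_ext' fun i => LinearMap.ext_ring (by simpa using h i))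
  refine ⟨i, fun j => (φ (Pi.single i 1))⁻¹ * φ (Pi.single j 1), inv_mul_cancel₀ hi, fun v => ?_⟩
  have h0 : φ (f v) = 0 := hle ⟨v, rfl⟩
  rw [LinearMap.pi_apply_eq_sum_univ φ] at h0
  simp only [dotProduct, mul_assoc, ← Finset.mul_sum]
  rw [mul_eq_zero]
  right
  rw [← h0]
  refine Finset.sum_congr rfl fun j _ => ?_
  rw [smul_eq_mul, mul_comm]
  congr 2
  ext k
  simp [Pi.single_apply, eq_comm]

open MeasureTheory Module in
/-- A set of Hausdorff dimension less than that of the ambient space is Haar null. -/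
theorem measure_eq_zero_of_dimH_lt_finrank {E : Type*} [NormedAddCommGroup E] [NormedSpace ℝ E]
    [FiniteDimensional ℝ E] [MeasurableSpace E] [BorelSpace E] (μ : Measure E)
    [μ.IsAddHaarMeasure] {s : Set E} (hs : dimH s < finrank ℝ E) : μ s = 0 := by
  refine measure_zero_of_dimH_lt (d := (finrank ℝ E : NNReal)) ?_ (by exact_mod_cast hs)
  rw [NNReal.coe_natCast]
  exact Measure.absolutelyContinuous_isAddHaarMeasure _ _

/-- Let `g : U ⊆ ℝ^m → ℝ^c` be smooth with surjective differential along
`A = g⁻¹(0)`. Then the set `Ã` of pairs `(y, l) ∈ ℝ^m × L(ℝ^n, ℝ^m)` with `y ∈ A` and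
`dg_y ∘ l` not surjective has Hausdorff dimension at most `m + n·m - (n + 1)`; in
particular it is Lebesgue null. -/
theorem statement15 {m n c : ℕ} (hm : 1 ≤ m) (hn : 1 ≤ n) (hc : 1 ≤ c)
    (U : Set (Fin m → ℝ)) (hU : IsOpen U)
    (g : (Fin m → ℝ) → (Fin c → ℝ)) (hg : ContDiffOn ℝ (⊤ : ℕ∞) g U)
    (hsurj : ∀ y ∈ U, g y = 0 → Function.Surjective ⇑(fderiv ℝ g y)) :
    dimH {yl : (Fin m → ℝ) × (Fin m → Fin n → ℝ) |
        yl.1 ∈ U ∧ g yl.1 = 0 ∧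
        ¬ Function.Surjective
          (fun v : Fin n → ℝ => fderiv ℝ g yl.1 ((Matrix.of yl.2).mulVec v))}
      ≤ ((m + n * m : ℕ) : ℝ≥0∞) - ((n : ℝ≥0∞) + 1) ∧
    MeasureTheory.volume {yl : (Fin m → ℝ) × (Fin m → Fin n → ℝ) |
        yl.1 ∈ U ∧ g yl.1 = 0 ∧
        ¬ Function.Surjective
          (fun v : Fin n → ℝ => fderiv ℝ g yl.1 ((Matrix.of yl.2).mulVec v))} = 0 := by
  obtain ⟨d, hd⟩ : ∃ d, m + n * m = d + (n + 1) :=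
    ⟨m + n * m - (n + 1), by have := Nat.mul_le_mul_left n hm; omega⟩
  have hg2 : ∀ y ∈ U, ContDiffAt ℝ 2 g y := fun y hy =>
    (hg.contDiffAt (hU.mem_nhds hy)).of_le <|
      WithTop.coe_le_coe.2 (le_top : (2 : ℕ∞) ≤ ⊤)
  set A := {yl : (Fin m → ℝ) × (Fin m → Fin n → ℝ) |
        yl.1 ∈ U ∧ g yl.1 = 0 ∧
        ¬ Function.Surjective
          (fun v : Fin n → ℝ => fderiv ℝ g yl.1 ((Matrix.of yl.2).mulVec v))}
  have hcover : A ⊆ ⋃ i : Fin c,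
      (fun p : (Fin m → ℝ) × (Fin c → ℝ) × (Fin m → Fin n → ℝ) => (p.1, p.2.2)) ''
        {p | p.1 ∈ U ∧ g p.1 = 0 ∧ p.2.1 i = 1 ∧ covectorPullback n g p = 0} := by
    rintro ⟨y, l⟩ ⟨hyU, hy0, hns⟩
    obtain ⟨i, w, hi, hw⟩ := exists_dotProduct_eq_zero_of_not_surjective
      (f := (fderiv ℝ g y).toLinearMap ∘ₗ (Matrix.of l).mulVecLin) hns
    refine Set.mem_iUnion.2 ⟨i, (y, w, l), ⟨hyU, hy0, hi, ?_⟩, rfl⟩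
    ext k
    have hk := hw (Pi.single k 1)
    simp only [LinearMap.comp_apply, Matrix.mulVecLin_apply, Matrix.mulVec_single_one] at hk
    exact hk
  have hdim : dimH A ≤ d := by
    refine (dimH_mono hcover).trans ?_
    rw [dimH_iUnion]
    refine iSup_le fun i => ?_
    exact ((LipschitzWith.prod_fst.prodMk
      (LipschitzWith.prod_snd.comp LipschitzWith.prod_snd)).dimH_image_le _).trans
        (dimH_incidence_le hg2 hsurj i hd.le)
  refine ⟨?_, ?_⟩
  · have : ((m + n * m : ℕ) : ℝ≥0∞) - ((n : ℝ≥0∞) + 1) = d := by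
      rw [hd]
      push_cast
      exact ENNReal.add_sub_cancel_right (by finiteness)
    rwa [this]
  · have hpi : (MeasureTheory.volume : MeasureTheory.Measure
        (Fin m → Fin n → ℝ)).IsAddHaarMeasure :=
      MeasureTheory.Measure.pi.isAddHaarMeasure fun _ => MeasureTheory.volume
    have hprod : (MeasureTheory.volume : MeasureTheory.Measure
        ((Fin m → ℝ) × (Fin m → Fin n → ℝ))).IsAddHaarMeasure :=
      MeasureTheory.Measure.prod.instIsAddHaarMeasure MeasureTheory.volume MeasureTheory.volume
    refine measure_eq_zero_of_dimH_lt_finrank _ (hdim.trans_lt ?_)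
    simp only [Module.finrank_prod, Module.finrank_pi, Module.finrank_pi_fintype,
      Fintype.card_fin, Finset.sum_const, Finset.card_univ, smul_eq_mul]
    norm_cast
    rw [mul_comm m n]
    omega
end

section
/- Let n, k, m ≥ 1 and c ≥ 1, let f : ℝ^k × ℝ^n → ℝ^m be of class C^2, and let g : ℝ^m → ℝ^c be a C^2 map whose differential dg_y is surjective at every point y of A := g^{-1}(0). Assume that the map E₁ : ℝ^k × B^n → ℝ^m × L(ℝ^n, ℝ^m) defined by E₁(t, x) := (f(t, x), ∂_x f(t, x)) has surjective differential at every point of ℝ^k × B^n, where B^n is the open unit ball of ℝ^n and L(ℝ^n, ℝ^m) is the space of linear maps. Then the set N := {t ∈ ℝ^k : there exists x ∈ B^n with g(f(t, x)) = 0 and the linear map dg_{f(t,x)} ∘ ∂_x f(t, x) : ℝ^n → ℝ^c not surjective} of parameters t for which f(t, ·) is not transverse to A on B^n has Hausdorff dimension at most k − 1; in particular N has Lebesgue measure zero in ℝ^k. -/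
open scoped ENNReal

open Module Set Topology

/-- Near a point where a map has surjective strict derivative, a set on which the map vanishes
has Hausdorff dimension at most the difference of the dimensions. -/
lemma exists_mem_nhdsWithin_dimH_le_of_surjective
    {E F : Type*} [NormedAddCommGroup E] [NormedSpace ℝ E] [FiniteDimensional ℝ E]
    [NormedAddCommGroup F] [NormedSpace ℝ F] [FiniteDimensional ℝ F]
    {Φ : E → F} {A : E →L[ℝ] F} {z : E} {Z : Set E} (hΦ : HasStrictFDerivAt Φ A z)
    (hA : Function.Surjective A) (hZ : ∀ x ∈ Z, Φ x = 0) :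
    ∃ s ∈ 𝓝[Z] z, dimH s ≤ ((finrank ℝ E - finrank ℝ F : ℕ) : ℝ≥0∞) := by
  obtain ⟨P, hP⟩ := Submodule.ClosedComplemented.of_finiteDimensional A.ker
  obtain ⟨K, hK, hanti⟩ := (A.prod P).toLinearMap.exists_antilipschitzWith <| by
    rw [LinearMap.ker_eq_bot']
    intro x hx
    obtain ⟨hx₁, hx₂⟩ : A x = 0 ∧ P x = 0 := by simpa [Prod.ext_iff] using hx
    simpa [hx₂] using (congrArg Subtype.val (hP ⟨x, hx₁⟩)).symm
  have hε : (0 : NNReal) < K⁻¹ / 2 := by positivity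
  obtain ⟨s, hs, happ⟩ := hΦ.approximates_deriv_on_nhds (c := K⁻¹ / 2) (Or.inr hε)
  refine ⟨Z ∩ s, Filter.inter_mem self_mem_nhdsWithin (mem_nhdsWithin_of_mem_nhds hs), ?_⟩
  have hPanti : AntilipschitzWith K (fun x : ↥(Z ∩ s) => P x) := by
    refine AntilipschitzWith.of_le_mul_dist fun x y => ?_
    have h₁ := happ x.1 x.2.2 y.1 y.2.2
    rw [hZ _ x.2.1, hZ _ y.2.1, sub_self, zero_sub, norm_neg] at h₁
    have h₂ := hanti.le_mul_dist x.1 y.1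
    rw [dist_eq_norm, dist_eq_norm, ← map_sub] at h₂
    change ‖x.1 - y.1‖ ≤ K * max ‖A (x.1 - y.1)‖ ‖P (x.1 - y.1)‖ at h₂
    rw [Subtype.dist_eq, dist_eq_norm, dist_eq_norm, ← map_sub]
    rcases le_total ‖A (x.1 - y.1)‖ ‖P (x.1 - y.1)‖ with h | h
    · rwa [max_eq_right h] at h₂
    · rw [max_eq_left h] at h₂
      have hK' : (0 : ℝ) < K := hK
      have h₃ : (K : ℝ) * ‖A (x.1 - y.1)‖ ≤ ‖x.1 - y.1‖ / 2 := by
        calc (K : ℝ) * ‖A (x.1 - y.1)‖ ≤ K * (((K⁻¹ / 2 : NNReal) : ℝ) * ‖x.1 - y.1‖) := by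
              gcongr
          _ = ‖x.1 - y.1‖ / 2 := by push_cast; field_simp
      have h₄ : ‖x.1 - y.1‖ ≤ 0 := by linarith
      exact h₄.trans (by positivity)
  have hker : finrank ℝ A.ker = finrank ℝ E - finrank ℝ F := by
    have h₁ := A.toLinearMap.finrank_range_add_finrank_ker
    rw [LinearMap.range_eq_top.2 hA, finrank_top] at h₁
    change finrank ℝ A.toLinearMap.ker = _
    omega
  calc dimH (Z ∩ s) = dimH (univ : Set ↥(Z ∩ s)) := by
        rw [← (isometry_subtype_coe (s := Z ∩ s)).dimH_image, image_univ, Subtype.range_coe]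
    _ ≤ dimH ((fun x : ↥(Z ∩ s) => P x) '' univ) := hPanti.le_dimH_image _
    _ ≤ dimH (univ : Set A.ker) := dimH_mono (subset_univ _)
    _ = _ := by rw [Real.dimH_univ_eq_finrank, hker]

/-- A set on which a map vanishes, with surjective strict derivative at each of its points,
has Hausdorff dimension at most the difference of the dimensions. -/
lemma dimH_le_of_forall_surjective
    {E F : Type*} [NormedAddCommGroup E] [NormedSpace ℝ E] [FiniteDimensional ℝ E]
    [NormedAddCommGroup F] [NormedSpace ℝ F] [FiniteDimensional ℝ F]
    {Φ : E → F} {Z : Set E}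
    (hZ : ∀ z ∈ Z, Φ z = 0)
    (hΦ : ∀ z ∈ Z, ∃ A : E →L[ℝ] F, HasStrictFDerivAt Φ A z ∧ Function.Surjective A) :
    dimH Z ≤ ((finrank ℝ E - finrank ℝ F : ℕ) : ℝ≥0∞) := by
  by_contra! h
  obtain ⟨z, hz, hlt⟩ := exists_mem_nhdsWithin_lt_dimH_of_lt_dimH h
  obtain ⟨A, hA, hsurj⟩ := hΦ z hz
  obtain ⟨s, hs, hle⟩ := exists_mem_nhdsWithin_dimH_le_of_surjective hA hsurj hZ
  exact (hlt s hs).not_ge hle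

/-- A non-surjective linear map into `ℝ^c` is annihilated by a functional normalised to take the
value `1` on some basis vector. -/
lemma exists_functional_of_not_surjective {V : Type*} [NormedAddCommGroup V] [NormedSpace ℝ V]
    {c : ℕ} {T : V →L[ℝ] (Fin c → ℝ)} (hT : ¬ Function.Surjective T) :
    ∃ (i : Fin c) (l : (Fin c → ℝ) →L[ℝ] ℝ), l (Pi.single i 1) = 1 ∧ l.comp T = 0 := by
  have hlt : T.toLinearMap.range < ⊤ :=
    lt_top_iff_ne_top.2 fun h => hT (LinearMap.range_eq_top.1 h)
  obtain ⟨l, hl, hker⟩ := Submodule.exists_le_ker_of_lt_top _ hlt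
  obtain ⟨i, hi⟩ : ∃ i, l (Pi.single i 1) ≠ 0 := by
    by_contra! h
    exact hl (LinearMap.pi_ext' fun i => LinearMap.ext_ring (by simpa using h i))
  refine ⟨i, (l (Pi.single i 1))⁻¹ • l.toContinuousLinearMap, by simp [hi], ?_⟩
  ext v
  have hv : l (T v) = 0 := hker ⟨v, rfl⟩
  simp [hv]

/-- The system `g y = 0`, `l ∘ dg_y ∘ L = 0`, `l w = 1` in the unknowns `((y, L), l)` is
submersive where `dg_y` is surjective and `l w = 1`. -/
lemma exists_surjective_hasStrictFDerivAt_degeneracy {V Y W : Type*}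
    [NormedAddCommGroup V] [NormedSpace ℝ V] [NormedAddCommGroup Y] [NormedSpace ℝ Y]
    [NormedAddCommGroup W] [NormedSpace ℝ W]
    {g : Y → W} (hg : ContDiff ℝ (2 : ℕ) g) {y : Y} (hy : Function.Surjective (fderiv ℝ g y))
    (L : V →L[ℝ] Y) {l : W →L[ℝ] ℝ} {w : W} (hl : l w = 1) :
    ∃ D : ((Y × (V →L[ℝ] Y)) × (W →L[ℝ] ℝ)) →L[ℝ] W × (V →L[ℝ] ℝ) × ℝ,
      HasStrictFDerivAt (fun q : (Y × (V →L[ℝ] Y)) × (W →L[ℝ] ℝ) =>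
        (g q.1.1, q.2.comp ((fderiv ℝ g q.1.1).comp q.1.2), q.2 w - 1)) D ((y, L), l) ∧
      Function.Surjective D := by
  set q₀ : (Y × (V →L[ℝ] Y)) × (W →L[ℝ] ℝ) := ((y, L), l) with hq₀
  have hfst : HasStrictFDerivAt (fun q : (Y × (V →L[ℝ] Y)) × (W →L[ℝ] ℝ) => q.1.1)
      ((ContinuousLinearMap.fst ℝ _ _).comp (ContinuousLinearMap.fst ℝ _ _)) q₀ :=
    hasStrictFDerivAt_fst.comp q₀ hasStrictFDerivAt_fst
  have hmid : HasStrictFDerivAt (fun q : (Y × (V →L[ℝ] Y)) × (W →L[ℝ] ℝ) => q.1.2)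
      ((ContinuousLinearMap.snd ℝ _ _).comp (ContinuousLinearMap.fst ℝ _ _)) q₀ :=
    hasStrictFDerivAt_snd.comp q₀ hasStrictFDerivAt_fst
  have hsnd : HasStrictFDerivAt (fun q : (Y × (V →L[ℝ] Y)) × (W →L[ℝ] ℝ) => q.2)
      (ContinuousLinearMap.snd ℝ _ _) q₀ :=
    hasStrictFDerivAt_snd
  have hg₁ : HasStrictFDerivAt g (fderiv ℝ g y) y :=
    hg.contDiffAt.hasStrictFDerivAt (by norm_num)
  have hg₂ : HasStrictFDerivAt (fderiv ℝ g) (fderiv ℝ (fderiv ℝ g) y) y :=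
    (hg.fderiv_right (m := 1) (by norm_num)).contDiffAt.hasStrictFDerivAt (by norm_num)
  refine ⟨_, (hg₁.comp q₀ hfst).prodMk ((hsnd.clm_comp ((hg₂.comp q₀ hfst).clm_comp hmid)).prodMk
    ((hsnd.clm_apply (hasStrictFDerivAt_const w q₀)).sub_const 1)), ?_⟩
  rintro ⟨a, β, r⟩
  obtain ⟨v, hv⟩ := hy a
  obtain ⟨u, hu⟩ := hy w
  let γ : V →L[ℝ] ℝ := β - l.comp ((fderiv ℝ (fderiv ℝ g) y v).comp L)
    - r • l.comp ((fderiv ℝ g y).comp L)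
  refine ⟨((v, γ.smulRight u), r • l), ?_⟩
  refine Prod.ext ?_ (Prod.ext ?_ ?_)
  · simp [hv]
  · ext x
    simp [γ, hu, hl, hq₀]
    ring
  · simp [hl]

/-- Parametric transversality: if `f : ℝ^k × ℝ^n → ℝ^m` is `C²`,
`g : ℝ^m → ℝ^c` is `C²` with surjective differential along `A = g⁻¹(0)`, and the 1-jet
evaluation `E₁ (t,x) = (f (t,x), ∂ₓf (t,x))` is a submersion on `ℝ^k × Bⁿ`, then the set of
parameters `t` for which `f (t, ·)` is not transverse to `A` on `Bⁿ` has Hausdorff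
dimension at most `k - 1`; in particular it is Lebesgue null. -/
theorem statement19 {n k m c : ℕ} (hn : 1 ≤ n) (hk : 1 ≤ k) (hm : 1 ≤ m) (hc : 1 ≤ c)
    (f : (Fin k → ℝ) × (Fin n → ℝ) → (Fin m → ℝ)) (hf : ContDiff ℝ (2 : ℕ) f)
    (g : (Fin m → ℝ) → (Fin c → ℝ)) (hg : ContDiff ℝ (2 : ℕ) g)
    (hgsurj : ∀ y : Fin m → ℝ, g y = 0 → Function.Surjective ⇑(fderiv ℝ g y))
    (hE : ∀ (t : Fin k → ℝ) (x : Fin n → ℝ), ‖x‖ < 1 →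
      Function.Surjective ⇑(fderiv ℝ (fun p : (Fin k → ℝ) × (Fin n → ℝ) =>
        (f p, fderiv ℝ (fun x' => f (p.1, x')) p.2)) (t, x))) :
    dimH {t : Fin k → ℝ | ∃ x : Fin n → ℝ, ‖x‖ < 1 ∧ g (f (t, x)) = 0 ∧
        ¬ Function.Surjective
          ⇑((fderiv ℝ g (f (t, x))).comp (fderiv ℝ (fun x' => f (t, x')) x))}
      ≤ (k : ℝ≥0∞) - 1 ∧
    MeasureTheory.volume {t : Fin k → ℝ | ∃ x : Fin n → ℝ, ‖x‖ < 1 ∧ g (f (t, x)) = 0 ∧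
        ¬ Function.Surjective
          ⇑((fderiv ℝ g (f (t, x))).comp (fderiv ℝ (fun x' => f (t, x')) x))} = 0 := by
  set N := {t : Fin k → ℝ | ∃ x : Fin n → ℝ, ‖x‖ < 1 ∧ g (f (t, x)) = 0 ∧
        ¬ Function.Surjective
          ⇑((fderiv ℝ g (f (t, x))).comp (fderiv ℝ (fun x' => f (t, x')) x))}
  set J : (Fin k → ℝ) × (Fin n → ℝ) → (Fin m → ℝ) × ((Fin n → ℝ) →L[ℝ] (Fin m → ℝ)) :=
    fun p => (f p, fderiv ℝ (fun x' => f (p.1, x')) p.2) with hJ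
  have hJdiff : ContDiff ℝ 1 J := by
    have hpartial : ∀ p : (Fin k → ℝ) × (Fin n → ℝ), fderiv ℝ (fun x' => f (p.1, x')) p.2 =
        (fderiv ℝ f p).comp (ContinuousLinearMap.inr ℝ (Fin k → ℝ) (Fin n → ℝ)) := fun p =>
      ((hf.differentiable (by norm_num) p).hasFDerivAt.comp p.2
        (hasFDerivAt_prodMk_right p.1 p.2)).fderiv
    simp only [hJ, hpartial]
    exact (hf.of_le (by norm_num)).prodMk
      ((hf.fderiv_right (m := 1) (by norm_num)).clm_comp contDiff_const)
  let Ψ (i : Fin c) (q : ((Fin k → ℝ) × (Fin n → ℝ)) × ((Fin c → ℝ) →L[ℝ] ℝ)) :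
      (Fin c → ℝ) × ((Fin n → ℝ) →L[ℝ] ℝ) × ℝ :=
    (g (J q.1).1, q.2.comp ((fderiv ℝ g (J q.1).1).comp (J q.1).2), q.2 (Pi.single i 1) - 1)
  let Z (i : Fin c) : Set (((Fin k → ℝ) × (Fin n → ℝ)) × ((Fin c → ℝ) →L[ℝ] ℝ)) :=
    {q | ‖q.1.2‖ < 1 ∧ Ψ i q = 0}
  have hZ (i : Fin c) : dimH (Z i) ≤ ((k - 1 : ℕ) : ℝ≥0∞) := by
    have hdim : finrank ℝ (((Fin k → ℝ) × (Fin n → ℝ)) × ((Fin c → ℝ) →L[ℝ] ℝ)) -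
        finrank ℝ ((Fin c → ℝ) × ((Fin n → ℝ) →L[ℝ] ℝ) × ℝ) = k - 1 := by
      have hdual (d : ℕ) : finrank ℝ ((Fin d → ℝ) →L[ℝ] ℝ) = d := by
        rw [← (LinearMap.toContinuousLinearMap :
          ((Fin d → ℝ) →ₗ[ℝ] ℝ) ≃ₗ[ℝ] _).finrank_eq]
        simp
      simp only [finrank_prod, hdual, finrank_fin_fun, finrank_self]
      omega
    rw [← hdim]
    refine dimH_le_of_forall_surjective (Φ := Ψ i) (fun z hz => hz.2) ?_
    rintro ⟨⟨t, x⟩, l⟩ ⟨hx, hΨ⟩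
    have hg0 : g (J (t, x)).1 = 0 := congrArg Prod.fst hΨ
    have hl : l (Pi.single i 1) = 1 := sub_eq_zero.1 (congrArg (fun y => y.2.2) hΨ)
    obtain ⟨D, hD, hDsurj⟩ := exists_surjective_hasStrictFDerivAt_degeneracy hg
      (hgsurj _ hg0) (J (t, x)).2 hl
    have hJ' : HasStrictFDerivAt J (fderiv ℝ J (t, x)) (t, x) :=
      hJdiff.contDiffAt.hasStrictFDerivAt one_ne_zero
    refine ⟨_, HasStrictFDerivAt.comp (((t, x), l) : _ × _) hD
      (hJ'.prodMap (((t, x), l) : _ × _) (hasStrictFDerivAt_id l)), ?_⟩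
    exact hDsurj.comp ((hE t x hx).prodMap Function.surjective_id)
  have hsub : N ⊆ ⋃ i, (fun q : ((Fin k → ℝ) × (Fin n → ℝ)) × ((Fin c → ℝ) →L[ℝ] ℝ) =>
      q.1.1) '' Z i := by
    rintro t ⟨x, hx, hg0, hns⟩
    obtain ⟨i, l, hl, hcomp⟩ := exists_functional_of_not_surjective hns
    exact mem_iUnion.2 ⟨i, ((t, x), l), ⟨hx, Prod.ext hg0 (Prod.ext hcomp (sub_eq_zero.2 hl))⟩, rfl⟩
  have hdimN : dimH N ≤ ((k - 1 : ℕ) : ℝ≥0∞) := by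
    refine (dimH_mono hsub).trans ?_
    rw [dimH_iUnion]
    exact iSup_le fun i =>
      ((LipschitzWith.prod_fst.comp LipschitzWith.prod_fst).dimH_image_le _).trans (hZ i)
  refine ⟨by simpa using hdimN, ?_⟩
  refine measure_zero_of_dimH_lt (d := k) ?_ (hdimN.trans_lt ?_)
  · have h := MeasureTheory.hausdorffMeasure_pi_real (ι := Fin k)
    rw [Fintype.card_fin] at h
    rw [NNReal.coe_natCast, h]
  · exact_mod_cast Nat.sub_lt hk one_pos
end
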